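/- For every tree t ∈ Tree^∞(F, K ∪ {□}), every tree u ∈ Tree^∞(F,K), and every hole-valuation γ : K → M, the Markov-algebra tree interpretation satisfies r^M_{γ[□ ↦ r^M_γ(u)]}(t) = r^M_γ(t{□ ↜ u}). -/

import Mathlib

abbrev Pos := List ℕ

inductive Label (F : Type) (K : Type) where
  | sym (f : F)
  | var (k : K)
  | loop

def Label.arity {F K : Type} (ar : F → ℕ) : Label F K → ℕ
  | .sym f => ar f
  | .var _ => 0
  | .loop => 0

/-- A possibly-infinite tree, as a partial map from positions to labels. -/
abbrev PTree (F K : Type) := Pos → Option (Label F K)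

def IsTree {F K : Type} (ar : F → ℕ) (t : PTree F K) : Prop :=
  t [] ≠ none ∧
  (∀ (p : Pos) (j : ℕ), t (p ++ [j]) ≠ none → t p ≠ none) ∧
  (∀ (p : Pos) (l : Label F K), t p = some l →
    ∀ j : ℕ, (t (p ++ [j]) ≠ none ↔ 1 ≤ j ∧ j ≤ Label.arity ar l))

def subtree {F K : Type} (t : PTree F K) (p : Pos) : PTree F K := fun q => t (p ++ q)

def loopTree {F K : Type} : PTree F K := fun p => if p = [] then some Label.loop else none

/-- A relation `R` is compatible with the coinductive characterization of refinement. -/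
def RefineCompat {F K : Type} (ar : F → ℕ) (R : PTree F K → PTree F K → Prop) : Prop :=
  ∀ t₁ t₂, R t₁ t₂ →
    t₁ = loopTree ∨
    ∃ l : Label F K, l ≠ Label.loop ∧ t₁ [] = some l ∧ t₂ [] = some l ∧
      ∀ i : ℕ, 1 ≤ i → i ≤ Label.arity ar l → R (subtree t₁ [i]) (subtree t₂ [i])

/-- The refinement relation `⊑_T`: the largest relation compatible with the
coinductive characterization. -/
def Refine {F K : Type} (ar : F → ℕ) (t₁ t₂ : PTree F K) : Prop :=
  ∃ R, RefineCompat ar R ∧ R t₁ t₂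

/-- `s` is the supremum (w.r.t. `⊑_T`) of the ω-chain `c` of possibly-infinite trees. -/
def IsSupTree {F K : Type} (ar : F → ℕ) (c : ℕ → PTree F K) (s : PTree F K) : Prop :=
  (∀ i, Refine ar (c i) s) ∧ ∀ u, IsTree ar u → (∀ i, Refine ar (c i) u) → Refine ar s u

/- Substitution of the tree `u` for every occurrence of the hole variable `z` in `t`
(the coinductively defined substitution operator, given pointwise). -/
open Classical in
noncomputable def subst {F K : Type} (z : K) (t u : PTree F K) : PTree F K := fun p =>
  if h : ∃ q : Pos, q <+: p ∧ t q = some (Label.var z) then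
    u (p.drop h.choose.length)
  else t p

abbrev Prob : Type := Set.Icc (0 : ℝ) 1

/-- The program alphabet: ε, sequencing, conditional-, probabilistic-, and
nondeterministic-choice. -/
inductive PSym (A : Type) (L : Type) where
  | eps
  | seq (act : A)
  | cond (φ : L)
  | prob (p : Prob)
  | ndet

def PSym.arity {A L : Type} : PSym A L → ℕ
  | .eps => 0
  | .seq _ => 1
  | .cond _ => 2
  | .prob _ => 2
  | .ndet => 2

/-- A Markov algebra over logical conditions `L`: a dcpo with least element, a monoid
`⊗`, confluence operations `◃φ▹`, `⋄p`, `⌣` (all Scott-continuous), with `⌣` an upper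
semilattice operation dominating the other two confluences. -/
structure MarkovAlg (L : Type) (M : Type) [PartialOrder M] where
  bot : M
  one : M
  mul : M → M → M
  cond : L → M → M → M
  prob : Prob → M → M → M
  ndet : M → M → M
  bot_le : ∀ a, bot ≤ a
  dcpo : ∀ d : Set M, d.Nonempty → DirectedOn (· ≤ ·) d → ∃ s, IsLUB d s
  mul_assoc : ∀ a b c, mul (mul a b) c = mul a (mul b c)
  one_mul : ∀ a, mul one a = a
  mul_one : ∀ a, mul a one = a
  ndet_idem : ∀ a, ndet a a = a
  ndet_comm : ∀ a b, ndet a b = ndet b a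
  ndet_assoc : ∀ a b c, ndet (ndet a b) c = ndet a (ndet b c)
  cond_le_ndet : ∀ φ a b, ndet (cond φ a b) (ndet a b) = ndet a b
  prob_le_ndet : ∀ p a b, ndet (prob p a b) (ndet a b) = ndet a b
  mul_scott_left : ∀ a, ScottContinuous fun x => mul x a
  mul_scott_right : ∀ a, ScottContinuous (mul a)
  cond_scott_left : ∀ φ a, ScottContinuous fun x => cond φ x a
  cond_scott_right : ∀ φ a, ScottContinuous (cond φ a)
  prob_scott_left : ∀ p a, ScottContinuous fun x => prob p x a
  prob_scott_right : ∀ p a, ScottContinuous (prob p a)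
  ndet_scott_left : ∀ a, ScottContinuous fun x => ndet x a
  ndet_scott_right : ∀ a, ScottContinuous (ndet a)

/-- The approximating sequence of the coinductively defined tree interpretation
`r^M_γ` of possibly-infinite trees over the program alphabet, for the Markov-algebra
interpretation `(P, ia)` and hole-valuation `γ`. -/
def maSeq {A L K M : Type} [PartialOrder M] (P : MarkovAlg L M) (ia : A → M)
    (γ : K → M) : ℕ → PTree (PSym A L) K → M
  | 0, _ => P.bot
  | i + 1, t =>
    match t [] with
    | some (.sym .eps) => P.one
    | some (.sym (.seq act)) => P.mul (ia act) (maSeq P ia γ i (subtree t [1]))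
    | some (.sym (.cond φ)) =>
        P.cond φ (maSeq P ia γ i (subtree t [1])) (maSeq P ia γ i (subtree t [2]))
    | some (.sym (.prob p)) =>
        P.prob p (maSeq P ia γ i (subtree t [1])) (maSeq P ia γ i (subtree t [2]))
    | some (.sym .ndet) =>
        P.ndet (maSeq P ia γ i (subtree t [1])) (maSeq P ia γ i (subtree t [2]))
    | some (.var k) => γ k
    | _ => P.bot

/-- `r` is the coinductively defined Markov-algebra tree interpretation `r^M_γ`,
i.e. the pointwise supremum of the approximating sequence. -/
def IsTreeInterp {A L K M : Type} [PartialOrder M] (P : MarkovAlg L M) (ia : A → M)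
    (γ : K → M) (r : PTree (PSym A L) K → M) : Prop :=
  ∀ t, IsLUB (Set.range fun i => maSeq P ia γ i t) (r t)

/-- Nothing lies below a node labelled by a variable. -/
def VarsAreLeaves {F K : Type} (t : PTree F K) : Prop :=
  ∀ (p q : Pos) (k : K), t p = some (Label.var k) → t (p ++ q) ≠ none → q = []

theorem IsTree.ne_none_of_append {F K : Type} {ar : F → ℕ} {t : PTree F K} (ht : IsTree ar t)
    (p q : Pos) (h : t (p ++ q) ≠ none) : t p ≠ none := by
  induction q using List.reverseRecOn with
  | nil => simpa using h
  | append_singleton q j ih => exact ih (ht.2.1 _ j (by rwa [List.append_assoc]))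

theorem IsTree.varsAreLeaves {F K : Type} {ar : F → ℕ} {t : PTree F K} (ht : IsTree ar t) :
    VarsAreLeaves t := by
  intro p q k hp hq
  cases q with
  | nil => rfl
  | cons j q =>
    have hj : t (p ++ [j]) ≠ none :=
      ht.ne_none_of_append (p ++ [j]) q (by simpa using hq)
    have := (ht.2.2 p _ hp j).1 hj
    simp only [Label.arity] at this
    omega

theorem VarsAreLeaves.subtree {F K : Type} {t : PTree F K} (ht : VarsAreLeaves t) (p : Pos) :
    VarsAreLeaves (subtree t p) := by
  intro a b k ha hb
  exact ht (p ++ a) b k ha (by simpa [_root_.subtree] using hb)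

theorem subst_of_prefix {F K : Type} {z : K} {t : PTree F K} (ht : VarsAreLeaves t)
    (u : PTree F K) {p q : Pos} (hqp : q <+: p) (hq : t q = some (Label.var z)) :
    subst z t u p = u (p.drop q.length) := by
  have h : ∃ q : Pos, q <+: p ∧ t q = some (Label.var z) := ⟨q, hqp, hq⟩
  have heq : h.choose = q := by
    obtain ⟨hp', hz'⟩ := h.choose_spec
    rcases List.prefix_or_prefix_of_prefix hp' hqp with ⟨s, hs⟩ | ⟨s, hs⟩
    · have := ht _ s z hz' (by simp [hs, hq])
      simpa [this] using hs
    · have := ht _ s z hq (by simp [hs, hz'])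
      simpa [this] using hs.symm
  rw [subst, dif_pos h, heq]

theorem subst_of_forall_prefix {F K : Type} {z : K} {t : PTree F K} (u : PTree F K) {p : Pos}
    (h : ∀ q, q <+: p → t q ≠ some (Label.var z)) : subst z t u p = t p := by
  rw [subst, dif_neg]
  rintro ⟨q, hq, hz⟩
  exact h q hq hz

theorem subst_of_root_eq {F K : Type} {z : K} {t : PTree F K} (ht : VarsAreLeaves t)
    (u : PTree F K) (h : t [] = some (Label.var z)) : subst z t u = u := by
  funext p
  simpa using subst_of_prefix ht u (List.nil_prefix (l := p)) h

theorem subst_root {F K : Type} {z : K} {t : PTree F K} (u : PTree F K)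
    (h : t [] ≠ some (Label.var z)) : subst z t u [] = t [] := by
  refine subst_of_forall_prefix u fun q hq => ?_
  rwa [List.prefix_nil.1 hq]

theorem subtree_subst {F K : Type} {z : K} {t : PTree F K} (ht : VarsAreLeaves t)
    (u : PTree F K) (h : t [] ≠ some (Label.var z)) (i : ℕ) :
    subtree (subst z t u) [i] = subst z (subtree t [i]) u := by
  funext p
  change subst z t u (i :: p) = _
  by_cases hex : ∃ q, q <+: p ∧ subtree t [i] q = some (Label.var z)
  · obtain ⟨q, hqp, hq⟩ := hex
    rw [subst_of_prefix (ht.subtree [i]) u hqp hq,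
      subst_of_prefix ht u (q := i :: q) (List.cons_prefix_cons.2 ⟨rfl, hqp⟩) hq]
    rfl
  · push Not at hex
    rw [subst_of_forall_prefix u hex, subst_of_forall_prefix u]
    · rfl
    · intro q hq
      rcases List.prefix_cons_iff.1 hq with rfl | ⟨q', rfl, hq'⟩
      · exact h
      · exact hex q' hq'

section MarkovAlg

variable {A L K M : Type} [PartialOrder M] (P : MarkovAlg L M) (ia : A → M)

/-- The operation on interpretations denoted by a program symbol; arguments beyond the arity of
the symbol are ignored. -/
def MarkovAlg.op : PSym A L → M → M → M
  | .eps, _, _ => P.one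
  | .seq act, a, _ => P.mul (ia act) a
  | .cond φ, a, b => P.cond φ a b
  | .prob p, a, b => P.prob p a b
  | .ndet, a, b => P.ndet a b

theorem MarkovAlg.op_scott_left (f : PSym A L) (b : M) :
    ScottContinuous fun a => P.op ia f a b := by
  cases f with
  | eps => exact ScottContinuous.const P.one
  | seq act => exact P.mul_scott_right (ia act)
  | cond φ => exact P.cond_scott_left φ b
  | prob p => exact P.prob_scott_left p b
  | ndet => exact P.ndet_scott_left b

theorem MarkovAlg.op_scott_right (f : PSym A L) (a : M) : ScottContinuous (P.op ia f a) := by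
  cases f with
  | eps => exact ScottContinuous.const P.one
  | seq act => exact ScottContinuous.const (P.mul (ia act) a)
  | cond φ => exact P.cond_scott_right φ a
  | prob p => exact P.prob_scott_right p a
  | ndet => exact P.ndet_scott_right a

theorem MarkovAlg.op_mono (f : PSym A L) {a a' b b' : M} (ha : a ≤ a') (hb : b ≤ b') :
    P.op ia f a b ≤ P.op ia f a' b' :=
  ((P.op_scott_left ia f b).monotone ha).trans ((P.op_scott_right ia f a').monotone hb)

theorem ScottContinuous.le_of_isLUB_range {g : M → M} (hg : ScottContinuous g) {c : ℕ → M}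
    (hc : Monotone c) {s x : M} (hs : IsLUB (Set.range c) s) (h : ∀ i, g (c i) ≤ x) :
    g s ≤ x := by
  refine (hg (Set.range_nonempty c) hc.directed_le.directedOn_range hs).2 ?_
  rintro _ ⟨_, ⟨i, rfl⟩, rfl⟩
  exact h i

theorem MarkovAlg.op_le_of_isLUB (f : PSym A L) {c d : ℕ → M} (hc : Monotone c) (hd : Monotone d)
    {s s' x : M} (hs : IsLUB (Set.range c) s) (hs' : IsLUB (Set.range d) s')
    (h : ∀ i, P.op ia f (c i) (d i) ≤ x) : P.op ia f s s' ≤ x := by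
  refine (P.op_scott_left ia f s').le_of_isLUB_range hc hs fun i => ?_
  refine (P.op_scott_right ia f (c i)).le_of_isLUB_range hd hs' fun j => ?_
  exact (P.op_mono ia f (hc (le_max_left i j)) (hd (le_max_right i j))).trans (h _)

variable (γ : K → M)

theorem maSeq_succ_sym (i : ℕ) {t : PTree (PSym A L) K} {f : PSym A L}
    (h : t [] = some (.sym f)) :
    maSeq P ia γ (i + 1) t =
      P.op ia f (maSeq P ia γ i (subtree t [1])) (maSeq P ia γ i (subtree t [2])) := by
  cases f <;> simp [maSeq, h, MarkovAlg.op]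

theorem maSeq_succ_var (i : ℕ) {t : PTree (PSym A L) K} {k : K} (h : t [] = some (.var k)) :
    maSeq P ia γ (i + 1) t = γ k := by
  simp [maSeq, h]

theorem maSeq_loop (i : ℕ) {t : PTree (PSym A L) K} (h : t [] = some .loop) :
    maSeq P ia γ i t = P.bot := by
  cases i <;> simp [maSeq, h]

theorem maSeq_none (i : ℕ) {t : PTree (PSym A L) K} (h : t [] = none) :
    maSeq P ia γ i t = P.bot := by
  cases i <;> simp [maSeq, h]

theorem maSeq_monotone (t : PTree (PSym A L) K) : Monotone fun i => maSeq P ia γ i t := by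
  refine monotone_nat_of_le_succ fun i => ?_
  induction i generalizing t with
  | zero => exact P.bot_le _
  | succ i ih =>
    rcases h : t [] with _ | f | k | _
    · simp only [maSeq_none P ia γ _ h, le_refl]
    · simp only [maSeq_succ_sym P ia γ _ h]
      exact P.op_mono ia f (ih _) (ih _)
    · simp only [maSeq_succ_var P ia γ _ h, le_refl]
    · simp only [maSeq_loop P ia γ _ h, le_refl]

variable {P ia γ}

theorem IsTreeInterp.maSeq_le {r : PTree (PSym A L) K → M} (hr : IsTreeInterp P ia γ r) (i : ℕ)
    (t : PTree (PSym A L) K) : maSeq P ia γ i t ≤ r t :=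
  (hr t).1 ⟨i, rfl⟩

theorem IsTreeInterp.op_le {r : PTree (PSym A L) K → M} (hr : IsTreeInterp P ia γ r)
    {t : PTree (PSym A L) K} {f : PSym A L} (h : t [] = some (.sym f)) :
    P.op ia f (r (subtree t [1])) (r (subtree t [2])) ≤ r t := by
  refine P.op_le_of_isLUB ia f (maSeq_monotone P ia γ _) (maSeq_monotone P ia γ _)
    (hr _) (hr _) fun i => ?_
  rw [← maSeq_succ_sym P ia γ i h]
  exact hr.maSeq_le (i + 1) t

theorem IsTreeInterp.maSeq_subst_le [DecidableEq K] {r : PTree (PSym A L) K → M}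
    (hr : IsTreeInterp P ia γ r) (z : K) (u : PTree (PSym A L) K) (i : ℕ)
    {t : PTree (PSym A L) K} (ht : VarsAreLeaves t) :
    maSeq P ia γ i (subst z t u) ≤ maSeq P ia (Function.update γ z (r u)) i t := by
  induction i generalizing t with
  | zero => exact P.bot_le _
  | succ i ih =>
    by_cases hz : t [] = some (.var z)
    · rw [maSeq_succ_var _ _ _ _ hz, subst_of_root_eq ht u hz, Function.update_self]
      exact hr.maSeq_le _ u
    have hs := subst_root u hz
    rcases h : t [] with _ | f | k | _ <;> rw [h] at hs
    · exact (maSeq_none P ia γ _ hs).trans_le (P.bot_le _)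
    · rw [maSeq_succ_sym _ _ _ _ hs, maSeq_succ_sym _ _ _ _ h, subtree_subst ht u hz,
        subtree_subst ht u hz]
      exact P.op_mono ia f (ih (ht.subtree _)) (ih (ht.subtree _))
    · have hk : k ≠ z := by
        rintro rfl
        exact hz h
      rw [maSeq_succ_var _ _ _ _ hs, maSeq_succ_var _ _ _ _ h, Function.update_of_ne hk]
    · exact (maSeq_loop P ia γ _ hs).trans_le (P.bot_le _)

theorem IsTreeInterp.maSeq_update_le [DecidableEq K] {r : PTree (PSym A L) K → M}
    (hr : IsTreeInterp P ia γ r) (z : K) (u : PTree (PSym A L) K) (i : ℕ)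
    {t : PTree (PSym A L) K} (ht : VarsAreLeaves t) :
    maSeq P ia (Function.update γ z (r u)) i t ≤ r (subst z t u) := by
  induction i generalizing t with
  | zero => exact P.bot_le _
  | succ i ih =>
    by_cases hz : t [] = some (.var z)
    · rw [maSeq_succ_var _ _ _ _ hz, subst_of_root_eq ht u hz, Function.update_self]
    have hs := subst_root u hz
    rcases h : t [] with _ | f | k | _ <;> rw [h] at hs
    · exact (maSeq_none P ia _ _ h).trans_le (P.bot_le _)
    · rw [maSeq_succ_sym _ _ _ _ h]
      refine le_trans ?_ (hr.op_le hs)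
      rw [subtree_subst ht u hz, subtree_subst ht u hz]
      exact P.op_mono ia f (ih (ht.subtree _)) (ih (ht.subtree _))
    · have hk : k ≠ z := by
        rintro rfl
        exact hz h
      rw [maSeq_succ_var _ _ _ _ h, Function.update_of_ne hk, ← maSeq_succ_var P ia γ 0 hs]
      exact hr.maSeq_le 1 _
    · exact (maSeq_loop P ia _ _ h).trans_le (P.bot_le _)

end MarkovAlg

/-- The Markov-algebra tree interpretation commutes with substitution:
`r^M_{γ[□ ↦ r^M_γ(u)]}(t) = r^M_γ(t{□ ↜ u})`. -/
theorem treeInterp_subst {A L K M : Type} [PartialOrder M] [DecidableEq K]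
    (P : MarkovAlg L M) (ia : A → M) (z : K)
    (t u : PTree (PSym A L) K)
    (ht : IsTree PSym.arity t) (hu : IsTree PSym.arity u)
    (γ : K → M) (r r' : PTree (PSym A L) K → M)
    (hr : IsTreeInterp P ia γ r)
    (hr' : IsTreeInterp P ia (Function.update γ z (r u)) r') :
    r' t = r (subst z t u) := by
  refine le_antisymm ((hr' t).2 ?_) ((hr _).2 ?_)
  · rintro _ ⟨i, rfl⟩
    exact hr.maSeq_update_le z u i ht.varsAreLeaves
  · rintro _ ⟨i, rfl⟩
    exact (hr.maSeq_subst_le z u i ht.varsAreLeaves).trans (hr'.maSeq_le i t)
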